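/- arXiv:1503.01744 — 2 statements merged into one kernel-verified Lean document; each statement's English description precedes it below -/
import Mathlib

section
/- For every index k ≥ 1 such that the k-th prime p_k satisfies p_k < 10^6, the inequality p_{k+1}^k < p_k^{k+1} holds; equivalently, the sequence (p_k)^{1/k} is strictly decreasing over the primes p_k < 10^6. -/
/-- `nthPrime k` is the `k`-th prime with 1-based indexing: `nthPrime 1 = 2`,
`nthPrime 2 = 3`, `nthPrime 3 = 5`, ... -/
noncomputable def nthPrime (k : ℕ) : ℕ := Nat.nth Nat.Prime (k - 1)

/-! The recursions below are evaluated by the kernel, so the expensive ones are written with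
`Nat.rec` and the `Nat` operations the kernel computes natively. -/

/-- Whether `n` is coprime to `P`. -/
def coprimeTo (P n : ℕ) : Bool := Nat.beq (Nat.gcd (Nat.mod P n) n) 1

/-- The number of odd `n ∈ [2 * b, 2 * (b + 2 ^ d))` coprime to `P`. -/
noncomputable def oddCoprimeCount (P d : ℕ) : ℕ → ℕ :=
  Nat.rec
    (fun b => Nat.div 1 (Nat.gcd (Nat.mod P (Nat.succ (Nat.mul 2 b))) (Nat.succ (Nat.mul 2 b))))
    (fun d ih b => Nat.add (ih b) (ih (Nat.add b (Nat.pow 2 d)))) d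

/-- The largest `t ∈ (s, s + j]` with `2 * t + 1` coprime to `P`, or `s` if there is none. -/
noncomputable def lastCoprimeWithin (P s j : ℕ) : ℕ :=
  Nat.rec s (fun j ih =>
    cond (coprimeTo P (Nat.succ (Nat.mul 2 (Nat.add s (Nat.succ j))))) (Nat.add s (Nat.succ j)) ih) j

/-- Iterates `fun s => lastCoprimeWithin P s h` from `s`, at most `2 ^ i` times, until the value
reaches `e`. -/
noncomputable def jumpTo (P h e : ℕ) : ℕ → ℕ → ℕ
  | 0, s => cond (Nat.ble e s) s (lastCoprimeWithin P s h)
  | i + 1, s => cond (Nat.ble e s) s (jumpTo P h e i (jumpTo P h e i s))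

/-- The product of the `2 ^ r` numbers from `a` on. -/
noncomputable def rangeProd (r : ℕ) : ℕ → ℕ :=
  Nat.rec (fun a => a) (fun r ih a => Nat.mul (ih a) (ih (Nat.add a (Nat.pow 2 r)))) r

/-- Half of a prime gap `2 * h` that is harmless beyond `2 * b`, if there are at most `K` primes
up to the gap. -/
def harmlessHalfGap (b K : ℕ) : ℕ := Nat.log2 ((2 * b) ^ 8) * 6931 * b / (80000 * K)

/-- Numbers below the square of `sieveBound d + 1` are tested by the primes up to
`sieveBound d`. -/
def sieveBound (d : ℕ) : ℕ := 2 ^ ((d + 6) / 2)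

/-- Checks the prime gaps in consecutive blocks of lengths `2 * 2 ^ d`, for `d` in the list,
starting at `2 * b`, where `K` bounds the number of primes below `2 * b`. -/
noncomputable def sweep : List ℕ → ℕ → ℕ → Bool
  | [], b, _ => Nat.ble 500000 b
  | d :: ds, b, K =>
    let P := rangeProd ((d + 6) / 2) 1
    let K' := K + oddCoprimeCount P d b
    let h := harmlessHalfGap b K'
    let e := b + 2 ^ d
    Nat.ble (2 * (e + h)) ((sieveBound d + 1) ^ 2) && Nat.ble (sieveBound d + 1) (2 * b) &&
      Nat.ble 1 K' && Nat.ble e (jumpTo P h e (d + 1) (b - 1)) && sweep ds e K'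

theorem factorial_mul_rangeProd (r a : ℕ) :
    a.factorial * rangeProd r (a + 1) = (a + 2 ^ r).factorial := by
  induction r generalizing a with
  | zero => exact Nat.mul_comm _ _
  | succ r ih =>
    have hrec : rangeProd (r + 1) (a + 1) =
        rangeProd r (a + 1) * rangeProd r (a + 1 + 2 ^ r) := rfl
    rw [hrec, ← mul_assoc, ih, add_right_comm, ih, add_assoc, ← two_mul, ← pow_succ']

theorem rangeProd_eq_factorial (d : ℕ) :
    rangeProd ((d + 6) / 2) 1 = (sieveBound d).factorial := by
  simpa [sieveBound] using factorial_mul_rangeProd ((d + 6) / 2) 0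

theorem coprimeTo_iff {P n : ℕ} : coprimeTo P n = true ↔ n.Coprime P := by
  rw [coprimeTo, Nat.beq_eq]
  change Nat.gcd (P % n) n = 1 ↔ _
  rw [← Nat.gcd_rec]

theorem prime_of_coprime_factorial {B n : ℕ} (hn : 2 ≤ n) (hB : n < (B + 1) ^ 2)
    (h : n.Coprime B.factorial) : n.Prime := by
  by_contra hp
  have h1 : n.minFac ^ 2 ≤ n := Nat.minFac_sq_le_self (by lia) hp
  have h2 : n.minFac ≤ B := by
    by_contra! h2
    nlinarith
  have h3 : n.minFac ∣ 1 :=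
    h ▸ Nat.dvd_gcd n.minFac_dvd (Nat.dvd_factorial n.minFac_pos h2)
  have := Nat.minFac_prime (show n ≠ 1 by lia)
  exact this.one_lt.ne' (Nat.dvd_one.mp h3)

theorem Nat.Prime.coprime_factorial_of_gt {B p : ℕ} (hp : p.Prime) (h : B < p) :
    p.Coprime B.factorial := by
  rw [hp.coprime_iff_not_dvd, hp.dvd_factorial]
  lia

theorem count_le_add_oddCoprimeCount (B d b : ℕ) (hb : B + 1 ≤ 2 * b) (hb1 : 2 ≤ b) :
    Nat.count Nat.Prime (2 * (b + 2 ^ d)) ≤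
      Nat.count Nat.Prime (2 * b) + oddCoprimeCount B.factorial d b := by
  induction d generalizing b with
  | zero =>
    have hrec : oddCoprimeCount B.factorial 0 b =
        1 / Nat.gcd (B.factorial % (2 * b + 1)) (2 * b + 1) := rfl
    have heven : ¬ (2 * b).Prime := Nat.not_prime_mul (by lia) (by lia)
    rw [show 2 * (b + 2 ^ 0) = 2 * b + 1 + 1 by ring, Nat.count_succ, Nat.count_succ,
      if_neg heven, hrec, ← Nat.gcd_rec]
    split_ifs with hp
    · rw [hp.coprime_factorial_of_gt (by lia)]
    · simp
  | succ d ih =>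
    have hrec : oddCoprimeCount B.factorial (d + 1) b =
        oddCoprimeCount B.factorial d b + oddCoprimeCount B.factorial d (b + 2 ^ d) := rfl
    have h1 := ih b hb hb1
    have h2 := ih (b + 2 ^ d) (by lia) (by lia)
    rw [show b + 2 ^ d + 2 ^ d = b + 2 ^ (d + 1) by ring] at h2
    lia

/-- Every `n ∈ [a, c)` is followed by a prime at distance at most `g`. -/
def PrimeGapsLE (g a c : ℕ) : Prop := ∀ n, a ≤ n → n < c → ∃ q, q.Prime ∧ n < q ∧ q ≤ n + g

theorem PrimeGapsLE.trans {g a b c : ℕ} (h₁ : PrimeGapsLE g a b) (h₂ : PrimeGapsLE g b c) :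
    PrimeGapsLE g a c := fun n han hnc =>
  (lt_or_ge n b).elim (h₁ n han) fun h => h₂ n h hnc

theorem PrimeGapsLE.refl (g a : ℕ) : PrimeGapsLE g a a := fun n h h' => by lia

theorem primeGapsLE_lastCoprimeWithin {B s h j : ℕ} (hj : j ≤ h)
    (hB : 2 * (s + h) + 1 < (B + 1) ^ 2) :
    PrimeGapsLE (2 * h) (2 * s + 1) (2 * lastCoprimeWithin B.factorial s j + 1) := by
  induction j with
  | zero => exact PrimeGapsLE.refl _ _
  | succ j ih =>
    have hrec : lastCoprimeWithin B.factorial s (j + 1) =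
        cond (coprimeTo B.factorial (2 * (s + (j + 1)) + 1)) (s + (j + 1))
          (lastCoprimeWithin B.factorial s j) := rfl
    rw [hrec]
    cases hc : coprimeTo B.factorial (2 * (s + (j + 1)) + 1) with
    | false => exact ih (by lia)
    | true =>
      refine fun n hn hn' => ⟨2 * (s + (j + 1)) + 1, ?_, hn', by lia⟩
      exact prime_of_coprime_factorial (by lia) (by lia) (coprimeTo_iff.mp hc)

theorem primeGapsLE_jumpTo {B h e : ℕ} (hB : 2 * (e + h) ≤ (B + 1) ^ 2) (i s : ℕ) :
    PrimeGapsLE (2 * h) (2 * s + 1) (2 * jumpTo B.factorial h e i s + 1) := by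
  induction i generalizing s with
  | zero =>
    rw [jumpTo]
    cases hc : Nat.ble e s with
    | true => exact PrimeGapsLE.refl _ _
    | false =>
      have hse : ¬ e ≤ s := fun h => by simp [Nat.ble_eq_true_of_le h] at hc
      exact primeGapsLE_lastCoprimeWithin le_rfl (by lia)
  | succ i ih =>
    rw [jumpTo]
    cases Nat.ble e s with
    | true => exact PrimeGapsLE.refl _ _
    | false => exact (ih s).trans (ih _)

theorem mul_log_two_lt_log {b : ℕ} (hb : 1 ≤ b) :
    (Nat.log2 ((2 * b) ^ 8) : ℝ) * 6931 / 80000 < Real.log (2 * b : ℕ) := by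
  have hpos : 0 < (2 * b) ^ 8 := by positivity
  have h1 : 2 ^ Nat.log2 ((2 * b) ^ 8) ≤ (2 * b) ^ 8 := Nat.log2_self_le hpos.ne'
  have ht : 1 ≤ Nat.log2 ((2 * b) ^ 8) := by
    rw [Nat.le_log2 hpos.ne']
    calc 2 ^ 1 ≤ 2 ^ 8 := by norm_num
      _ ≤ (2 * b) ^ 8 := Nat.pow_le_pow_left (by lia) 8
  generalize Nat.log2 ((2 * b) ^ 8) = t at *
  have h2 : (2 : ℝ) ^ t ≤ ((2 * b : ℕ) : ℝ) ^ 8 := by exact_mod_cast h1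
  have h3 := Real.log_le_log (by positivity) h2
  rw [Real.log_pow, Real.log_pow] at h3
  have h4 := Real.log_two_gt_d9
  have h5 : (1 : ℝ) ≤ t := by exact_mod_cast ht
  push_cast at h3 ⊢
  nlinarith

theorem pow_lt_pow_succ_of_harmlessHalfGap {b K p q k : ℕ} (hb : 1 ≤ b) (hK : 1 ≤ K)
    (hbp : 2 * b ≤ p) (hq : q ≤ p + 2 * harmlessHalfGap b K) (hk : k ≤ K) :
    q ^ k < p ^ (k + 1) := by
  have hp0 : (0 : ℝ) < p := by exact_mod_cast (by lia : 0 < p)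
  have hb0 : (0 : ℝ) < b := by exact_mod_cast hb
  have hK0 : (0 : ℝ) < K := by exact_mod_cast hK
  have hbp' : ((2 * b : ℕ) : ℝ) ≤ p := by exact_mod_cast hbp
  have hlog : Real.log (2 * b : ℕ) ≤ Real.log p :=
    Real.log_le_log (by exact_mod_cast (by lia : 0 < 2 * b)) hbp'
  have ht := (mul_log_two_lt_log hb).trans_le hlog
  have hh : (harmlessHalfGap b K : ℝ) * (80000 * K) ≤ Nat.log2 ((2 * b) ^ 8) * 6931 * b := by
    exact_mod_cast Nat.div_mul_le_self (Nat.log2 ((2 * b) ^ 8) * 6931 * b) (80000 * K)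
  generalize harmlessHalfGap b K = h at *
  generalize (Nat.log2 ((2 * b) ^ 8) : ℝ) = t at *
  have hexp : (k : ℝ) * (2 * h / p) < Real.log p := by
    refine lt_of_le_of_lt ?_ ht
    have hkK : (k : ℝ) ≤ K := by exact_mod_cast hk
    push_cast at hbp'
    calc (k : ℝ) * (2 * h / p) ≤ K * (2 * h / (2 * b)) := by gcongr
      _ = h * (80000 * K) / (80000 * b) := by field_simp
      _ ≤ t * 6931 * b / (80000 * b) := by gcongr
      _ = t * 6931 / 80000 := by field_simp
  have hqp : (q : ℝ) ≤ p * Real.exp (2 * h / p) := by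
    have h1 : (q : ℝ) ≤ p + 2 * h := by exact_mod_cast hq
    calc (q : ℝ) ≤ p * (2 * h / p + 1) := by field_simp; linarith
      _ ≤ _ := by gcongr; exact Real.add_one_le_exp _
  have key : (q : ℝ) ^ k < (p : ℝ) ^ (k + 1) := by
    calc (q : ℝ) ^ k ≤ (p * Real.exp (2 * h / p)) ^ k := by gcongr
      _ = p ^ k * Real.exp (k * (2 * h / p)) := by rw [mul_pow, ← Real.exp_nat_mul]
      _ < p ^ k * p := by
        gcongr
        exact (Real.lt_log_iff_exp_lt hp0).mp hexp
      _ = _ := (pow_succ _ _).symm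
  exact_mod_cast key

theorem nthPrime_prime (k : ℕ) : (nthPrime k).Prime := Nat.prime_nth_prime _

theorem le_count_of_nthPrime_lt {k n : ℕ} (hk : 1 ≤ k) (h : nthPrime k < n) :
    k ≤ Nat.count Nat.Prime n := by
  have h1 := Nat.count_strict_mono (nthPrime_prime k) h
  rw [nthPrime, Nat.count_nth_of_infinite Nat.infinite_setOfPred_prime] at h1
  lia

theorem nthPrime_succ_le {k q : ℕ} (hk : 1 ≤ k) (hq : q.Prime) (h : nthPrime k < q) :
    nthPrime (k + 1) ≤ q :=
  calc Nat.nth Nat.Prime k ≤ Nat.nth Nat.Prime (Nat.count Nat.Prime q) :=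
        Nat.nth_monotone Nat.infinite_setOfPred_prime (le_count_of_nthPrime_lt hk h)
    _ = q := Nat.nth_count hq

theorem pow_lt_pow_succ_of_sweep {ds : List ℕ} {b K : ℕ} (hb : 2 ≤ b)
    (hK : Nat.count Nat.Prime (2 * b) ≤ K) (h : sweep ds b K = true) {k : ℕ} (hk : 1 ≤ k)
    (hbk : 2 * b ≤ nthPrime k) (hlt : nthPrime k < 10 ^ 6) :
    nthPrime (k + 1) ^ k < nthPrime k ^ (k + 1) := by
  induction ds generalizing b K with
  | nil =>
    rw [sweep] at h
    have := Nat.le_of_ble_eq_true h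
    lia
  | cons d ds ih =>
    simp only [sweep, rangeProd_eq_factorial, Bool.and_eq_true, Nat.ble_eq] at h
    obtain ⟨⟨⟨⟨hB, hb'⟩, hK1⟩, hjump⟩, hsweep⟩ := h
    have hcount := (count_le_add_oddCoprimeCount _ d b hb' hb).trans
      (Nat.add_le_add_right hK _)
    rcases lt_or_ge (nthPrime k) (2 * (b + 2 ^ d)) with hlast | hlast
    · have hgaps := primeGapsLE_jumpTo hB (d + 1) (b - 1)
      obtain ⟨q, hq, hpq, hqp⟩ := hgaps (nthPrime k) (by lia) (by lia)
      exact pow_lt_pow_succ_of_harmlessHalfGap (by lia) hK1 hbk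
        ((nthPrime_succ_le hk hq hpq).trans hqp) ((le_count_of_nthPrime_lt hk hlast).trans hcount)
    · exact ih (by lia) hcount hsweep hlast

theorem sweep_eq_true :
    sweep ((List.range 16).flatMap fun d => List.replicate 8 d) 8 6 = true := by
  decide +kernel

theorem count_prime_sixteen : Nat.count Nat.Prime 16 = 6 := by
  decide +kernel

theorem pow_lt_pow_succ_of_nthPrime_lt_sixteen {k : ℕ} (hk : 1 ≤ k) (h : nthPrime k < 16) :
    nthPrime (k + 1) ^ k < nthPrime k ^ (k + 1) := by
  have hcount : Nat.count Nat.Prime (nthPrime k) = k - 1 :=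
    Nat.count_nth_of_infinite Nat.infinite_setOfPred_prime _
  have hcheck : ∀ p < 16, p.Prime → ∃ q < 20, q.Prime ∧ p < q ∧
      q ^ (Nat.count Nat.Prime p + 1) < p ^ (Nat.count Nat.Prime p + 2) := by
    decide +kernel
  obtain ⟨q, -, hq, hpq, hlt⟩ := hcheck _ h (nthPrime_prime k)
  rw [hcount, show k - 1 + 1 = k by lia, show k - 1 + 2 = k + 1 by lia] at hlt
  exact (Nat.pow_le_pow_left (nthPrime_succ_le hk hq hpq) k).trans_lt hlt

theorem firoozbakht_up_to_1e6 (k : ℕ) (hk : 1 ≤ k)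
    (h : nthPrime k < 10 ^ 6) :
    nthPrime (k + 1) ^ k < nthPrime k ^ (k + 1) := by
  rcases lt_or_ge (nthPrime k) 16 with h16 | h16
  · exact pow_lt_pow_succ_of_nthPrime_lt_sixteen hk h16
  · exact pow_lt_pow_succ_of_sweep (by norm_num) count_prime_sixteen.le sweep_eq_true hk h16 h
end

section
/- If p_k and p_{k+1} are consecutive primes with p_{k+1} − p_k = 150, then p_{k+1}^k < p_k^{k+1}; that is, a prime gap of size 150 can never violate the Firoozbakht conjecture. -/
open Real Chebyshev

/-- The product of the primes up to 2111. -/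
def smallPrimeProduct : ℕ :=
  14467183489840893531030158483010544486196694270406696949730870724991225945471053328115368478389987350568515983803693462875667618725063524846108198177620929696636187457180885585421213657196739050882745884895279941177196835722991660774789671190721269350016713299619814944381466176879581764101773427957196608597668150484460171533535484514367618452470812047649573049250154086645719194190677950594984367718310117191465780069006410240022671391058662735776512741376689115316482072458503811027832346233224475715415530089509195518498958712942414667240959145771255573836362928179236434248870579982995821825860676679882196841131683233005237705140520901658675684403183705201344317801891544987796571233153458352105676988761712434597447805841713506922629850509545246070226546714684633257605190265304817775579050178609455552295304468810617593808977798721645465678954781131770891464105231070736774211300941090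

/-- Searching downwards from `2 * (s + j) + 1` to `2 * s + 3` for a number `2 * t + 1` coprime to
`smallPrimeProduct`, returns `t + 1`, or `0` if there is none. Recursors and the raw arithmetic
operations are used because they reduce fast in the kernel. -/
def coprimeSearch (s j : ℕ) : ℕ :=
  Nat.rec 0 (fun i ih => Bool.rec ih ((s.add i).add 2)
    (Nat.beq ((((s.add i).mul 2).add 3).gcd smallPrimeProduct) 1)) j

/-- Iterates `coprimeSearch · 74` `2 ^ m` times. Eliminating the intermediate value makes the
kernel reduce it to a literal. -/
def iterCoprimeSearch (m : ℕ) : ℕ → ℕ :=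
  Nat.rec (fun s => coprimeSearch s 74) (fun _ f s => Nat.rec 0 (fun t _ => f t) (f s)) m

theorem prime_dvd_smallPrimeProduct {p : ℕ} (hp : p.Prime) (h : p < 2113) :
    p ∣ smallPrimeProduct := by
  have key : (List.range 2111).all
      (fun q => !(Nat.gcd (q + 2) smallPrimeProduct).beq 1) = true := by decide +kernel
  have h2 := hp.two_le
  have hgcd := List.all_eq_true.1 key (p - 2) (List.mem_range.2 (by lia))
  rw [Nat.sub_add_cancel h2, Bool.not_eq_true', ← Bool.not_eq_true, Nat.beq_eq] at hgcd
  by_contra hdvd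
  exact hgcd ((Nat.Prime.coprime_iff_not_dvd hp).2 hdvd)

theorem prime_of_coprime_smallPrimeProduct {n : ℕ} (h1 : 1 < n) (hn : n < 2113 ^ 2)
    (h : Nat.gcd n smallPrimeProduct = 1) : n.Prime := by
  by_contra hnp
  have hmin : n.minFac.Prime := Nat.minFac_prime h1.ne'
  have hsq : n.minFac ^ 2 ≤ n := Nat.minFac_sq_le_self (by lia) hnp
  have hlt : n.minFac < 2113 := lt_of_pow_lt_pow_left₀ 2 (by simp) (hsq.trans_lt hn)
  have hd : n.minFac ∣ Nat.gcd n smallPrimeProduct :=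
    Nat.dvd_gcd n.minFac_dvd (prime_dvd_smallPrimeProduct hmin hlt)
  rw [h] at hd
  exact hmin.one_lt.ne' (Nat.dvd_one.1 hd)

theorem coprimeSearch_eq_succ {s j t : ℕ} (h : coprimeSearch s j = t + 1) :
    s < t ∧ t ≤ s + j ∧ Nat.gcd (2 * t + 1) smallPrimeProduct = 1 := by
  induction j with
  | zero => exact absurd h (by simp [coprimeSearch])
  | succ i ih =>
    have hstep : coprimeSearch s (i + 1) =
        bif Nat.beq (((s + i) * 2 + 3).gcd smallPrimeProduct) 1
          then s + i + 2 else coprimeSearch s i := by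
      rw [Bool.cond_eq_ite]
      change Bool.rec (motive := fun _ => ℕ) (coprimeSearch s i) (s + i + 2)
        (Nat.beq (((s + i) * 2 + 3).gcd smallPrimeProduct) 1) = _
      cases Nat.beq (((s + i) * 2 + 3).gcd smallPrimeProduct) 1 <;> rfl
    rw [hstep] at h
    cases hb : Nat.beq (((s + i) * 2 + 3).gcd smallPrimeProduct) 1 with
    | true =>
      rw [hb, cond_true] at h
      obtain rfl : t = s + i + 1 := by lia
      refine ⟨by lia, by lia, ?_⟩
      rw [show 2 * (s + i + 1) + 1 = (s + i) * 2 + 3 by ring]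
      exact Nat.eq_of_beq_eq_true hb
    | false =>
      rw [hb, cond_false] at h
      obtain ⟨h1, h2, h3⟩ := ih h
      exact ⟨h1, by lia, h3⟩

theorem exists_prime_of_iterCoprimeSearch (m : ℕ) {s t : ℕ}
    (h : iterCoprimeSearch m s = t + 1) (ht : 2 * t + 1 < 2113 ^ 2) :
    s ≤ t ∧ ∀ p, 2 * s + 1 ≤ p → p < 2 * t + 1 → ∃ r, r.Prime ∧ p < r ∧ r < p + 150 := by
  induction m generalizing s t with
  | zero =>
    obtain ⟨h1, h2, h3⟩ := coprimeSearch_eq_succ (j := 74) h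
    exact ⟨h1.le, fun p hp hpt =>
      ⟨2 * t + 1, prime_of_coprime_smallPrimeProduct (by lia) ht h3, hpt, by lia⟩⟩
  | succ m ih =>
    cases hu : iterCoprimeSearch m s with
    | zero =>
      change Nat.rec 0 (fun t _ => iterCoprimeSearch m t) (iterCoprimeSearch m s) = t + 1 at h
      rw [hu] at h
      exact absurd h (by simp)
    | succ u =>
      change Nat.rec 0 (fun t _ => iterCoprimeSearch m t) (iterCoprimeSearch m s) = t + 1 at h
      rw [hu] at h
      obtain ⟨hut, h2⟩ := ih h ht
      obtain ⟨hsu, h1⟩ := ih hu (by lia)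
      refine ⟨hsu.trans hut, fun p hp hpt => ?_⟩
      rcases lt_or_ge p (2 * u + 1) with hpu | hpu
      · exact h1 p hp hpu
      · exact h2 p hpu hpt

theorem exists_prime_lt_add_150 {p : ℕ} (h : p < 2 ^ 22) :
    ∃ r, r.Prime ∧ p < r ∧ r < p + 150 := by
  rcases lt_or_ge p 2113 with hp' | hp'
  · by_contra! hgap
    have h3 := hgap 3 (by norm_num)
    have h151 := hgap 151 (by norm_num)
    have h293 := hgap 293 (by norm_num)
    have h439 := hgap 439 (by norm_num)
    have h587 := hgap 587 (by norm_num)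
    have h733 := hgap 733 (by norm_num)
    have h881 := hgap 881 (by norm_num)
    have h1021 := hgap 1021 (by norm_num)
    have h1163 := hgap 1163 (by norm_num)
    have h1307 := hgap 1307 (by norm_num)
    have h1453 := hgap 1453 (by norm_num)
    have h1601 := hgap 1601 (by norm_num)
    have h1747 := hgap 1747 (by norm_num)
    have h1889 := hgap 1889 (by norm_num)
    have h2029 := hgap 2029 (by norm_num)
    have h2161 := hgap 2161 (by norm_num)
    lia
  · have hiter : iterCoprimeSearch 15 1056 = 2231769 + 1 := by decide +kernel
    exact (exists_prime_of_iterCoprimeSearch 15 hiter (by norm_num)).2 p hp' (by lia)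

theorem integral_inv_log_sq_le {a x c : ℝ} (ha : 1 < a) (hax : a ≤ x) (hc0 : 0 ≤ c)
    (hc : 2 * c ≤ (c - 1) * log a) :
    ∫ t in a..x, 1 / log t ^ 2 ≤ c * x / log x ^ 2 - c * a / log a ^ 2 := by
  have hlog : 0 < log a := log_pos ha
  have hpos : ∀ t, a ≤ t → 0 < log t := fun t ht => log_pos (ha.trans_le ht)
  have hderiv : ∀ t, a ≤ t → HasDerivAt (fun t => c * t / log t ^ 2)
      ((c * log t - 2 * c) / log t ^ 3) t := by
    intro t ht
    have h0 := (hpos t ht).ne'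
    have ht0 : t ≠ 0 := by linarith
    convert! ((hasDerivAt_id t).const_mul c).fun_div ((hasDerivAt_log ht0).fun_pow 2)
      (pow_ne_zero 2 h0) using 1
    simp only [id]
    field_simp
    ring
  refine intervalIntegral.integral_le_sub_of_hasDeriv_right_of_le hax
    (fun t ht => (hderiv t ht.1).continuousAt.continuousWithinAt)
    (fun t ht => (hderiv t ht.1.le).hasDerivWithinAt)
    ((intervalIntegrable_iff_integrableOn_Icc_of_le hax).1
      (intervalIntegrable_one_div_log_sq ha (ha.trans_le hax))) fun t ht => ?_
  have h0 := hpos t ht.1.le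
  have hle : log a ≤ log t := log_le_log (by linarith) ht.1.le
  have hc1 : 0 ≤ c - 1 := nonneg_of_mul_nonneg_left (by linarith) hlog
  have hct : log t ≤ c * log t - 2 * c := by nlinarith
  rw [div_le_div_iff₀ (by positivity) (by positivity)]
  nlinarith [mul_le_mul_of_nonneg_right hct (pow_pos h0 2).le]

theorem primeCounting_le_log_four_mul {x : ℝ} (hx : 512 ≤ x) :
    (Nat.primeCounting ⌊x⌋₊ : ℝ) ≤
      log 4 * (x / log x + 3 / 2 * x / log x ^ 2 + 1062) := by
  have hlog2 := log_two_gt_d9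
  have h512 : log 512 = 9 * log 2 := by
    rw [show (512 : ℝ) = 2 ^ 9 by norm_num, log_pow]
    norm_num
  have hint : ∀ {a b : ℝ}, 1 < a → 1 < b → IntervalIntegrable (fun t => 1 / log t ^ 2)
      MeasureTheory.volume a b := intervalIntegrable_one_div_log_sq
  have hsmall : ∫ t in (2 : ℝ)..512, 1 / log t ^ 2 ≤ 1062 := by
    have hle : ∫ t in (2 : ℝ)..512, 1 / log t ^ 2 ≤ ∫ _ in (2 : ℝ)..512, 1 / log 2 ^ 2 := by
      refine intervalIntegral.integral_mono_on (by norm_num) (hint (by norm_num) (by norm_num))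
        (by simp) fun t ht => ?_
      have := log_le_log two_pos ht.1
      gcongr
    refine hle.trans ?_
    rw [intervalIntegral.integral_const, smul_eq_mul, mul_one_div,
      div_le_iff₀ (by positivity)]
    nlinarith
  have hlarge := integral_inv_log_sq_le (a := 512) (x := x) (c := 3 / 2) (by norm_num) hx
    (by norm_num) (by linarith)
  have hnonneg : 0 ≤ 3 / 2 * 512 / log 512 ^ 2 := by positivity
  have htheta : ∫ t in 2..x, θ t / (t * log t ^ 2) ≤ ∫ t in 2..x, log 4 * (1 / log t ^ 2) := by
    refine intervalIntegral.integral_mono_on (by linarith)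
      ((intervalIntegrable_iff_integrableOn_Icc_of_le (by linarith)).2
        (integrableOn_theta_div_id_mul_log_sq x))
      ((hint (by norm_num) (by linarith)).const_mul _) fun t ht => ?_
    have ht0 : 0 < t := by linarith [ht.1]
    have hlogt : 0 < log t := log_pos (by linarith [ht.1])
    have := theta_le_log4_mul_x ht0.le
    rw [div_le_iff₀ (by positivity)]
    field_simp
    linarith
  rw [intervalIntegral.integral_const_mul, ← intervalIntegral.integral_add_adjacent_intervals
    (hint (b := 512) (by norm_num) (by norm_num)) (hint (by norm_num) (by linarith))] at htheta
  have hmain : θ x / log x ≤ log 4 * (x / log x) := by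
    rw [← mul_div_assoc]
    have := theta_le_log4_mul_x (x := x) (by linarith)
    have hlogx : 0 < log x := log_pos (by linarith)
    gcongr
  have hlog4 : 0 < log 4 := log_pos (by norm_num)
  rw [primeCounting_eq_theta_div_log_add_integral (by linarith)]
  calc _ ≤ _ := add_le_add hmain htheta
    _ = log 4 * (x / log x + ((∫ t in (2 : ℝ)..512, 1 / log t ^ 2) +
        ∫ t in (512 : ℝ)..x, 1 / log t ^ 2)) := by ring
    _ ≤ _ := mul_le_mul_of_nonneg_left (by linarith) hlog4.le

theorem mul_primeCounting_lt_mul_log {x : ℝ} (hx : 2 ^ 22 ≤ x) :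
    150 * (Nat.primeCounting ⌊x⌋₊ : ℝ) < x * log x := by
  have hx' : (4194304 : ℝ) ≤ x := by norm_num at hx; exact hx
  have hlog2 := log_two_gt_d9
  have hlog2' := log_two_lt_d9
  have hlog4 : log 4 = 2 * log 2 := by
    rw [show (4 : ℝ) = 2 ^ 2 by norm_num, log_pow]
    norm_num
  have hL : 15.249 ≤ log x := by
    have := log_le_log (by positivity) hx
    rw [log_pow] at this
    norm_num at this
    linarith
  have hbound := primeCounting_le_log_four_mul (x := x) (by linarith)
  set L := log x
  have hL0 : 0 < L := by linarith
  have hL2 : 0 ≤ 1 / L ^ 2 := by positivity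
  have hquot : 1 / L + 3 / 2 / L ^ 2 ≤ 0.00474 * L := by
    rw [div_add_div _ _ hL0.ne' (by positivity), div_le_iff₀ (by positivity)]
    have h1 : 15.249 ^ 2 ≤ L ^ 2 := by gcongr
    have h2 : L + 3 / 2 ≤ 0.00474 * L ^ 3 := by nlinarith
    nlinarith
  have hprod : 15.249 * 4194304 ≤ L * x := by gcongr
  have hsum : x / L + 3 / 2 * x / L ^ 2 + 1062 ≤ 0.00476 * (L * x) := by
    have : x / L + 3 / 2 * x / L ^ 2 = (1 / L + 3 / 2 / L ^ 2) * x := by ring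
    rw [this]
    nlinarith [mul_le_mul_of_nonneg_right hquot (by linarith : 0 ≤ x)]
  have hlog4' : log 4 ≤ 1.3863 := by linarith
  have hle : log 4 * (x / L + 3 / 2 * x / L ^ 2 + 1062) ≤ 1.3863 * (0.00476 * (L * x)) := by
    gcongr
  have hLx : 0 < L * x := by positivity
  linarith

theorem firoozbakht_gap_150 (k : ℕ) (hk : 1 ≤ k)
    (hgap : nthPrime (k + 1) - nthPrime k = 150) :
    nthPrime (k + 1) ^ k < nthPrime k ^ (k + 1) := by
  obtain ⟨m, rfl⟩ : ∃ m, k = m + 1 := ⟨k - 1, by lia⟩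
  simp only [nthPrime, Nat.add_sub_cancel] at hgap ⊢
  have hinf := Nat.infinite_setOfPred_prime
  set p := Nat.nth Nat.Prime m with hp
  have hprime : p.Prime := Nat.prime_nth_prime m
  have hq : Nat.nth Nat.Prime (m + 1) = p + 150 := by lia
  have hcount : Nat.primeCounting p = m + 1 := Nat.count_nth_succ_of_infinite hinf m
  rw [hq]
  rcases lt_or_ge p (2 ^ 22) with hlt | hge
  · obtain ⟨r, hr, hpr, hrp⟩ := exists_prime_lt_add_150 hlt
    have h1 : m + 1 ≤ Nat.count Nat.Prime r := by
      rw [← hcount]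
      exact Nat.count_monotone _ hpr
    have h2 : Nat.nth Nat.Prime (m + 1) ≤ Nat.nth Nat.Prime (Nat.count Nat.Prime r) :=
      Nat.nth_monotone hinf h1
    rw [Nat.nth_count hr, hq] at h2
    lia
  · have hp0 : (0 : ℝ) < p := mod_cast hprime.pos
    have hpi := mul_primeCounting_lt_mul_log (x := p) (mod_cast hge)
    rw [Nat.floor_natCast, hcount] at hpi
    have hfrac : log ((p + 150) / p) ≤ 150 / p := by
      have := log_le_sub_one_of_pos (x := (p + 150) / p) (by positivity)
      have h1 : ((p : ℝ) + 150) / p - 1 = 150 / p := by field_simp; ring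
      linarith
    rw [log_div (by positivity) hp0.ne'] at hfrac
    have hmul : ((m + 1 : ℕ) : ℝ) * (150 / p) < log p := by
      rw [← mul_div_assoc, div_lt_iff₀ hp0]
      linarith
    have hreal : ((p : ℝ) + 150) ^ (m + 1) < (p : ℝ) ^ (m + 1 + 1) := by
      rw [← log_lt_log_iff (by positivity) (by positivity), log_pow, log_pow]
      have := mul_le_mul_of_nonneg_left hfrac (Nat.cast_nonneg (α := ℝ) (m + 1))
      push_cast at this hmul ⊢
      linarith
    exact_mod_cast hreal
end
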